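/- For a > 0 and 0 < α < 1, the integral J(s) = ∫_{0}^{∞} x^α e^{i(a x² − s x)} dx satisfies J(s) ∼ √π · 2^{−α} · e^{i(π − s²/a)/4} · a^{−(α+1/2)} · s^{α} as s → +∞; in particular |J(s)| / s^α → √π · 2^{−α} · a^{−(α+1/2)}. -/

import Mathlib

open Filter Real Complex
open MeasureTheory

noncomputable def frK (b : ℂ) (y : ℝ) : ℂ :=
  (2 * b / (1 + (y:ℂ)^2) + (1 - (y:ℂ)^2) / (1 + (y:ℂ)^2)^2) * Complex.exp (-b * (y:ℂ)^2)

noncomputable def frH (b : ℂ) (y : ℝ) : ℂ :=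
  ((y:ℂ) / (1 + (y:ℂ)^2)) * Complex.exp (-b * (y:ℂ)^2)

lemma one_add_sq_ne (y : ℝ) : (1 + (y:ℂ)^2) ≠ 0 := by
  have h : (1 + y^2 : ℝ) ≠ 0 := by positivity
  exact_mod_cast h

lemma norm_one_add_sq (y : ℝ) : ‖(1 + (y:ℂ)^2)‖ = 1 + y^2 := by
  have : (1 + (y:ℂ)^2) = ((1 + y^2 : ℝ) : ℂ) := by push_cast; rfl
  rw [this, Complex.norm_real, Real.norm_of_nonneg (by positivity)]

lemma norm_exp_le (b : ℂ) (hb : 0 ≤ b.re) (y : ℝ) : ‖Complex.exp (-b * (y:ℂ)^2)‖ ≤ 1 := by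
  have h : (-b * (y:ℂ)^2).re = - (b.re * y^2) := by
    have : (y:ℂ)^2 = ((y^2 : ℝ) : ℂ) := by push_cast; rfl
    rw [this, Complex.re_mul_ofReal]; simp
  rw [Complex.norm_exp, h, Real.exp_le_one_iff]
  have := mul_nonneg hb (sq_nonneg y)
  linarith

lemma frK_bound (b : ℂ) (hb : 0 ≤ b.re) (y : ℝ) :
    ‖frK b y‖ ≤ (2 * ‖b‖ + 1) * (1 + y^2)⁻¹ := by
  have hp : 0 < 1 + y^2 := by positivity
  unfold frK
  rw [norm_mul]
  have h2 : ‖(1 - (y:ℂ)^2)‖ ≤ 1 + y^2 := by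
    have : (1 - (y:ℂ)^2) = ((1 - y^2 : ℝ) : ℂ) := by push_cast; rfl
    rw [this, Complex.norm_real, Real.norm_eq_abs, abs_le]
    constructor <;> nlinarith [sq_nonneg y]
  have h1 : ‖2 * b / (1 + (y:ℂ)^2) + (1 - (y:ℂ)^2) / (1 + (y:ℂ)^2)^2‖
      ≤ (2 * ‖b‖ + 1) * (1 + y^2)⁻¹ := by
    refine (norm_add_le _ _).trans ?_
    rw [norm_div, norm_div, norm_pow, norm_one_add_sq, norm_mul]
    have : ‖(1 - (y:ℂ)^2)‖ / (1 + y^2)^2 ≤ (1+y^2)⁻¹ := by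
      rw [div_le_iff₀ (by positivity)]
      have : (1+y^2)⁻¹ * (1+y^2)^2 = 1 + y^2 := by field_simp
      rw [this]; exact h2
    have e : ‖(2:ℂ)‖ * ‖b‖ / (1+y^2) = 2 * ‖b‖ * (1+y^2)⁻¹ := by
      simp [div_eq_mul_inv]
    rw [e]; linarith
  calc _ ≤ ((2 * ‖b‖ + 1) * (1 + y^2)⁻¹) * 1 :=
        mul_le_mul h1 (norm_exp_le b hb y) (norm_nonneg _) (by positivity)
    _ = _ := mul_one _

lemma frK_cont (b : ℂ) : Continuous (frK b) := by
  unfold frK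
  have h1 : Continuous fun y : ℝ => (1 + (y:ℂ)^2) := by fun_prop
  refine Continuous.mul (Continuous.add ?_ ?_) (by fun_prop)
  · exact continuous_const.div h1 one_add_sq_ne
  · exact Continuous.div (by fun_prop) (h1.pow 2) (fun y => pow_ne_zero _ (one_add_sq_ne y))

lemma frK_int (b : ℂ) (hb : 0 ≤ b.re) : Integrable (frK b) :=
  Integrable.mono' (integrable_inv_one_add_sq.const_mul (2 * ‖b‖ + 1))
    (frK_cont b).aestronglyMeasurable (Eventually.of_forall (frK_bound b hb))

lemma frH_deriv (b : ℂ) (y : ℝ) :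
    HasDerivAt (frH b) (frK b y - 2 * b * Complex.exp (-b * (y:ℂ)^2)) y := by
  have hy := one_add_sq_ne y
  have h0 : HasDerivAt (fun z : ℂ => (z / (1 + z^2)) * Complex.exp (-b * z^2))
      (frK b y - 2 * b * Complex.exp (-b * (y:ℂ)^2)) (y:ℂ) := by
    have h1 : HasDerivAt (fun z : ℂ => z^2) (2 * (y:ℂ)) (y:ℂ) := by
      simpa using hasDerivAt_pow 2 (y:ℂ)
    have h2 := ((hasDerivAt_id (y:ℂ)).div (h1.const_add 1) hy).mul
      ((h1.const_mul (-b)).cexp)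
    refine h2.congr_deriv ?_
    unfold frK
    simp only [id, Pi.div_apply]
    field_simp
    ring
  exact h0.comp_ofReal

lemma frH_bound (b : ℂ) (hb : 0 ≤ b.re) (y : ℝ) : ‖frH b y‖ ≤ |y| / (1 + y^2) := by
  unfold frH
  rw [norm_mul, norm_div, norm_one_add_sq, Complex.norm_real, Real.norm_eq_abs]
  calc _ ≤ |y| / (1 + y^2) * 1 :=
        mul_le_mul_of_nonneg_left (norm_exp_le b hb y) (by positivity)
    _ = _ := mul_one _

lemma frH_bound2 (b : ℂ) (hb : 0 ≤ b.re) (y : ℝ) : ‖frH b y‖ ≤ |y|⁻¹ := by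
  refine (frH_bound b hb y).trans ?_
  rcases eq_or_ne y 0 with rfl | h
  · simp
  · have : 0 < |y| := abs_pos.mpr h
    rw [div_le_iff₀ (by positivity), ← sq_abs]
    have : |y|⁻¹ * (1 + |y|^2) = |y|⁻¹ + |y| := by field_simp
    rw [this]
    have : 0 < |y|⁻¹ := by positivity
    linarith

lemma frH_top (b : ℂ) (hb : 0 ≤ b.re) : Tendsto (frH b) atTop (nhds 0) :=
  squeeze_zero_norm (frH_bound2 b hb) (tendsto_inv_atTop_zero.comp tendsto_abs_atTop_atTop)

lemma frH_bot (b : ℂ) (hb : 0 ≤ b.re) : Tendsto (frH b) atBot (nhds 0) :=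
  squeeze_zero_norm (frH_bound2 b hb) (tendsto_inv_atTop_zero.comp tendsto_abs_atBot_atTop)

lemma frK_integral_pos (b : ℂ) (hb : 0 < b.re) :
    ∫ y, frK b y = 2 * b * ((π:ℂ) / b) ^ (1/2 : ℂ) := by
  have hi : Integrable fun y : ℝ => 2 * b * Complex.exp (-b * (y:ℂ)^2) :=
    (integrable_cexp_neg_mul_sq hb).const_mul _
  have h := integral_of_hasDerivAt_of_tendsto (frH_deriv b) ((frK_int b hb.le).sub hi)
    (frH_bot b hb.le) (frH_top b hb.le)
  rw [integral_sub (frK_int b hb.le) hi, integral_const_mul, integral_gaussian_complex hb] at h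
  linear_combination h

lemma frK_integral (a : ℝ) (ha : 0 < a) :
    ∫ y, frK (-(a * I)) y =
      2 * (-(a * I)) * ((Real.sqrt (π / a) : ℝ) * Complex.exp ((π / 4 : ℝ) * I)) := by
  have hre : (-(a * I) : ℂ).re = 0 := by simp
  have hne : (-(a * I) : ℂ) ≠ 0 := by simp [ha.ne']
  have hb : Tendsto (fun ε : ℝ => (ε : ℂ) - a * I) (nhdsWithin 0 (Set.Ioi 0))
      (nhds (-(a * I))) := by
    have : Continuous fun ε : ℝ => (ε : ℂ) - a * I := by fun_prop
    have := this.tendsto 0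
    simp only [ofReal_zero, zero_sub] at this
    exact this.mono_left nhdsWithin_le_nhds
  have h1 : Tendsto (fun ε : ℝ => ∫ y, frK ((ε : ℂ) - a * I) y) (nhdsWithin 0 (Set.Ioi 0))
      (nhds (∫ y, frK (-(a * I)) y)) := by
    refine tendsto_integral_filter_of_dominated_convergence
      (fun y => (2 * (1 + a) + 1) * (1 + y^2)⁻¹) ?_ ?_ ?_ ?_
    · exact Eventually.of_forall fun ε => (frK_cont _).aestronglyMeasurable
    · have : Set.Ioo (0:ℝ) 1 ∈ nhdsWithin (0:ℝ) (Set.Ioi 0) := Ioo_mem_nhdsGT one_pos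
      filter_upwards [this] with ε hε
      refine Eventually.of_forall fun y => (frK_bound _ (by simp [hε.1.le]) y).trans ?_
      have hn : ‖(ε : ℂ) - a * I‖ ≤ 1 + a := by
        refine (norm_sub_le _ _).trans ?_
        simp only [norm_real, norm_mul, norm_I, mul_one, Real.norm_eq_abs,
          abs_of_pos hε.1, abs_of_pos ha]
        linarith [hε.2]
      gcongr
    · exact integrable_inv_one_add_sq.const_mul _
    · refine Eventually.of_forall fun y => ?_
      have : Continuous fun b : ℂ => frK b y := by unfold frK; fun_prop
      exact (this.tendsto _).comp hb
  have hq : (π:ℂ) / (-(a * I)) = ((π / a : ℝ) : ℂ) * I := by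
    have : (a:ℂ) ≠ 0 := by exact_mod_cast ha.ne'
    push_cast
    field_simp
    simp
  have h2 : Tendsto (fun ε : ℝ => ∫ y, frK ((ε : ℂ) - a * I) y) (nhdsWithin 0 (Set.Ioi 0))
      (nhds (2 * (-(a * I)) * ((π:ℂ) / (-(a * I))) ^ (1/2 : ℂ))) := by
    have hc : ContinuousAt (fun b : ℂ => 2 * b * ((π:ℂ) / b) ^ (1/2 : ℂ)) (-(a * I)) := by
      refine ContinuousAt.mul (by fun_prop) ?_
      refine ContinuousAt.cpow (continuousAt_const.div continuousAt_id hne) continuousAt_const ?_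
      rw [hq]
      right
      simp [ha.ne', Real.pi_ne_zero]
    refine (hc.tendsto.comp hb).congr' ?_
    filter_upwards [self_mem_nhdsWithin] with ε hε
    exact (frK_integral_pos _ (by simpa using hε)).symm
  rw [tendsto_nhds_unique h1 h2]
  congr 1
  have hpa : 0 < π / a := div_pos Real.pi_pos ha
  have hne2 : ((π / a : ℝ) : ℂ) * I ≠ 0 :=
    mul_ne_zero (by exact_mod_cast hpa.ne') I_ne_zero
  have hs : Real.sqrt (π / a) = Real.exp (Real.log (π / a) * (1/2)) := by
    rw [Real.sqrt_eq_rpow, Real.rpow_def_of_pos hpa]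
  rw [hq, Complex.cpow_def_of_ne_zero hne2, Complex.log_ofReal_mul hpa I_ne_zero, Complex.log_I,
    hs, Complex.ofReal_exp, ← Complex.exp_add]
  congr 1
  push_cast
  ring

lemma fresnel_prim (a : ℝ) (ha : 0 < a) : ∃ E : ℝ → ℂ, ∃ C : ℝ,
    (∀ y : ℝ, HasDerivAt E (Complex.exp ((a * y^2 : ℝ) * I)) y) ∧ (∀ y, ‖E y‖ ≤ C) ∧
    (∀ y, y * ‖E y‖ ≤ C) ∧
    Tendsto E atBot (nhds (-((Real.sqrt (π / a) : ℝ) * Complex.exp ((π / 4 : ℝ) * I)))) := by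
  set b : ℂ := -(a * I) with hbdef
  have hre : (0:ℝ) ≤ b.re := by simp [hbdef]
  have hne : b ≠ 0 := by simp [hbdef, ha.ne']
  have hint := frK_int b hre
  set T : ℝ → ℂ := fun y => ∫ t in Set.Ioi y, frK b t with hT
  have hTeq : ∀ y, T y = T 0 - ∫ t in (0:ℝ)..y, frK b t := by
    intro y
    have := intervalIntegral.integral_Ioi_sub_Ioi' (a := 0) (b := y) hint.integrableOn hint.integrableOn
    rw [← this]; ring
  have hTd : ∀ y, HasDerivAt T (- frK b y) y := by
    intro y
    have h1 := intervalIntegral.integral_hasDerivAt_right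
      ((frK_cont b).intervalIntegrable 0 y)
      (frK_cont b).stronglyMeasurable.stronglyMeasurableAtFilter (frK_cont b).continuousAt
    have h2 := h1.const_sub (T 0)
    exact h2.congr_of_eventuallyEq (Eventually.of_forall hTeq)
  set M := 2 * ‖b‖ + 1 with hM
  have hM0 : 0 ≤ M := by positivity
  have hTb : ∀ y, ‖T y‖ ≤ M * π := by
    intro y
    calc ‖T y‖ ≤ ∫ t in Set.Ioi y, M * (1 + t^2)⁻¹ :=
          norm_integral_le_of_norm_le (integrable_inv_one_add_sq.const_mul M).integrableOn
            (Eventually.of_forall (frK_bound b hre))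
      _ ≤ ∫ t : ℝ, M * (1 + t^2)⁻¹ :=
          setIntegral_le_integral (integrable_inv_one_add_sq.const_mul M)
            (Eventually.of_forall fun t => by positivity)
      _ = M * π := by rw [integral_const_mul, integral_univ_inv_one_add_sq]
  have hTb2 : ∀ y, 0 < y → y * ‖T y‖ ≤ M := by
    intro y hy
    have : ‖T y‖ ≤ M * y⁻¹ := by
      calc ‖T y‖ ≤ ∫ t in Set.Ioi y, M * t ^ (-2 : ℝ) := by
            refine norm_integral_le_of_norm_le
              ((integrableOn_Ioi_rpow_of_lt (by norm_num) hy).const_mul M) ?_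
            refine (ae_restrict_iff' measurableSet_Ioi).mpr (Eventually.of_forall fun t ht => ?_)
            have ht0 : 0 < t := hy.trans ht
            refine (frK_bound b hre t).trans ?_
            refine mul_le_mul_of_nonneg_left ?_ hM0
            rw [Real.rpow_neg ht0.le, Real.rpow_two]
            exact inv_anti₀ (by positivity) (by linarith)
        _ = M * y⁻¹ := by
            rw [integral_const_mul, integral_Ioi_rpow_of_lt (by norm_num) hy]
            norm_num [Real.rpow_neg_one]
    calc y * ‖T y‖ ≤ y * (M * y⁻¹) := by gcongr
      _ = M := by field_simp
  have hTbot : Tendsto T atBot (nhds (∫ y, frK b y)) := by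
    have h := intervalIntegral_tendsto_integral_Iic (0:ℝ) hint.integrableOn tendsto_id
    have h' := h.const_add (T 0)
    have e : T 0 + ∫ x in Set.Iic 0, frK b x = ∫ y, frK b y := by
      rw [add_comm]; exact intervalIntegral.integral_Iic_add_Ioi hint.integrableOn hint.integrableOn
    rw [e] at h'
    refine h'.congr fun y => ?_
    rw [hTeq y, intervalIntegral.integral_symm 0 (id y)]; simp [sub_eq_add_neg]
  have h2b : 0 < ‖(2 * b)⁻¹‖ := by simp [hne]
  refine ⟨fun y => (2 * b)⁻¹ * (-(frH b y) - T y), ‖(2*b)⁻¹‖ * (1 + M * π), ?_, ?_, ?_, ?_⟩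
  · intro y
    refine (((frH_deriv b y).neg.sub (hTd y)).const_mul _).congr_deriv ?_
    have : Complex.exp ((a * y^2 : ℝ) * I) = Complex.exp (-b * (y:ℂ)^2) := by
      congr 1; simp [hbdef]; ring
    rw [this]; field_simp; ring
  · intro y
    rw [norm_mul]
    refine mul_le_mul_of_nonneg_left ((norm_sub_le _ _).trans ?_) h2b.le
    rw [norm_neg]
    refine add_le_add ((frH_bound b hre y).trans ?_) (hTb y)
    rw [div_le_one (by positivity), ← sq_abs]
    nlinarith [sq_nonneg (|y| - 1), abs_nonneg y]
  · intro y
    rcases le_or_gt y 0 with hy | hy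
    · exact (mul_nonpos_of_nonpos_of_nonneg hy (norm_nonneg _)).trans (by positivity)
    rw [norm_mul, mul_left_comm]
    refine mul_le_mul_of_nonneg_left ?_ h2b.le
    have h1 : ‖-(frH b y) - T y‖ ≤ y⁻¹ + ‖T y‖ := by
      refine (norm_sub_le _ _).trans ?_
      rw [norm_neg]
      have := frH_bound2 b hre y
      rw [abs_of_pos hy] at this
      linarith
    have h2 : M ≤ M * π := by nlinarith [Real.pi_gt_three]
    calc _ ≤ y * (y⁻¹ + ‖T y‖) := by gcongr
      _ = 1 + y * ‖T y‖ := by field_simp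
      _ ≤ _ := by linarith [hTb2 y hy]
  · have h := (((frH_bot b hre).neg.sub hTbot).const_mul ((2 * b)⁻¹))
    rw [frK_integral a ha, ← hbdef] at h
    convert h using 2
    field_simp
    simp

lemma bound_int (α : ℝ) (hα0 : 0 < α) (hα1 : α < 1) :
    IntegrableOn (fun v : ℝ => v ^ (α - 1) * (1 + v)⁻¹) (Set.Ioi 0) := by
  have hm : Measurable (fun v : ℝ => v ^ (α - 1) * (1 + v)⁻¹) := by fun_prop
  rw [← Set.Ioc_union_Ioi_eq_Ioi (zero_le_one (α := ℝ))]
  refine IntegrableOn.union ?_ ?_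
  · have h : IntegrableOn (fun v : ℝ => v ^ (α - 1)) (Set.Ioc 0 1) := by
      have := intervalIntegral.intervalIntegrable_rpow' (a := 0) (b := 1) (r := α - 1) (by linarith)
      rwa [intervalIntegrable_iff, Set.uIoc_of_le zero_le_one] at this
    refine Integrable.mono' h hm.aestronglyMeasurable ?_
    refine (ae_restrict_iff' measurableSet_Ioc).mpr (Eventually.of_forall fun t ht => ?_)
    have h0 : 0 < t := ht.1
    have h1 : 0 < t ^ (α - 1) := Real.rpow_pos_of_pos h0 _
    rw [Real.norm_of_nonneg (by positivity)]
    exact mul_le_of_le_one_right h1.le (inv_le_one_of_one_le₀ (by linarith))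
  · have h : IntegrableOn (fun v : ℝ => v ^ (α - 2)) (Set.Ioi 1) :=
      integrableOn_Ioi_rpow_of_lt (by linarith) one_pos
    refine Integrable.mono' h hm.aestronglyMeasurable ?_
    refine (ae_restrict_iff' measurableSet_Ioi).mpr (Eventually.of_forall fun t ht => ?_)
    have h0 : 0 < t := one_pos.trans ht
    have h1 : 0 < t ^ (α - 1) := Real.rpow_pos_of_pos h0 _
    rw [Real.norm_of_nonneg (by positivity)]
    have : t ^ (α - 2) = t ^ (α - 1) * t⁻¹ := by
      rw [← Real.rpow_neg_one, ← Real.rpow_add h0]; congr 1; ring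
    rw [this]
    gcongr
    linarith

lemma ptw_bound (α : ℝ) (hα0 : 0 < α) (C v : ℝ) (z : ℂ) (hv : 0 < v)
    (h : (1 + v) * ‖z‖ ≤ C) :
    ‖((α * v ^ (α - 1) : ℝ) : ℂ) * z‖ ≤ (α * C) * (v ^ (α - 1) * (1 + v)⁻¹) := by
  have h1 : 0 < v ^ (α - 1) := Real.rpow_pos_of_pos hv _
  rw [norm_mul, Complex.norm_real, Real.norm_of_nonneg (by positivity)]
  have : ‖z‖ ≤ C * (1 + v)⁻¹ := by
    rw [← div_eq_mul_inv, le_div_iff₀ (by positivity)]; linarith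
  calc _ ≤ α * v ^ (α - 1) * (C * (1 + v)⁻¹) := by gcongr
    _ = _ := by ring

lemma meas_aux (α : ℝ) (g : ℝ → ℂ) (hg : Continuous g) (μ : Measure ℝ) :
    AEStronglyMeasurable (fun v : ℝ => ((α * v ^ (α - 1) : ℝ) : ℂ) * g v) μ := by
  have h1 : Measurable (fun v : ℝ => ((α * v ^ (α - 1) : ℝ) : ℂ)) := by fun_prop
  exact (h1.mul hg.measurable).aestronglyMeasurable

lemma int_aux (α : ℝ) (hα0 : 0 < α) (hα1 : α < 1) (g : ℝ → ℂ) (hg : Continuous g) (C : ℝ)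
    (h : ∀ v, 0 < v → (1 + v) * ‖g v‖ ≤ C) :
    IntegrableOn (fun v : ℝ => ((α * v ^ (α - 1) : ℝ) : ℂ) * g v) (Set.Ioi 0) := by
  refine Integrable.mono' ((bound_int α hα0 hα1).const_mul (α * C)) (meas_aux α g hg _) ?_
  exact (ae_restrict_iff' measurableSet_Ioi).mpr
    (Eventually.of_forall fun t ht => ptw_bound α hα0 C t _ ht (h t ht))

lemma limit_aux (α : ℝ) (hα0 : 0 < α) (hα1 : α < 1) (E : ℝ → ℂ) (C : ℝ) (L : ℂ)
    (hE : Continuous E) (h1 : ∀ y, ‖E y‖ ≤ C) (h2 : ∀ y, y * ‖E y‖ ≤ C)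
    (hL : Tendsto E atBot (nhds L)) :
    Tendsto (fun l : ℝ => ∫ v in Set.Ioi (0:ℝ), ((α * v ^ (α - 1) : ℝ) : ℂ) * E (l * (v - 1)))
      atTop (nhds L) := by
  have htop : Tendsto E atTop (nhds 0) := by
    refine squeeze_zero_norm' (a := fun y => C * y⁻¹) ?_ ?_
    · filter_upwards [eventually_gt_atTop 0] with y hy
      rw [← div_eq_mul_inv, le_div_iff₀ hy]; linarith [h2 y]
    · simpa using tendsto_inv_atTop_zero.const_mul C
  have hlim : ∫ v in Set.Ioi (0:ℝ), (Set.Ioc (0:ℝ) 1).indicator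
      (fun v => ((α * v ^ (α - 1) : ℝ) : ℂ) * L) v = L := by
    rw [setIntegral_indicator measurableSet_Ioc,
      Set.inter_eq_right.mpr (fun x hx => hx.1), integral_mul_const, integral_complex_ofReal,
      ← intervalIntegral.integral_of_le zero_le_one, intervalIntegral.integral_const_mul,
      integral_rpow (Or.inl (by linarith))]
    simp [hα0.ne']
  rw [← hlim]
  refine tendsto_integral_filter_of_dominated_convergence
    (fun v => (α * (3 * C)) * (v ^ (α - 1) * (1 + v)⁻¹)) ?_ ?_ ?_ ?_
  · exact Eventually.of_forall fun l =>
      meas_aux α (fun v => E (l * (v - 1))) (hE.comp (by fun_prop)) _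
  · filter_upwards [eventually_ge_atTop 1] with l hl
    refine (ae_restrict_iff' measurableSet_Ioi).mpr
      (Eventually.of_forall fun v hv => ptw_bound α hα0 _ v _ hv ?_)
    have a1 := h1 (l * (v - 1))
    have a2 := h2 (l * (v - 1))
    have hC : 0 ≤ C := (norm_nonneg _).trans a1
    set n := ‖E (l * (v - 1))‖
    have : (v - 1) * n ≤ C := by
      by_contra! hh
      nlinarith
    linarith
  · exact (bound_int α hα0 hα1).const_mul _
  · refine (ae_restrict_iff' measurableSet_Ioi).mpr ?_
    have hae : ∀ᵐ v : ℝ, v ≠ 1 := by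
      simp [ae_iff]
    filter_upwards [hae] with v hv1 hv0
    rcases lt_or_gt_of_ne hv1 with h | h
    · rw [Set.indicator_of_mem (show v ∈ Set.Ioc (0:ℝ) 1 from ⟨hv0, h.le⟩)]
      refine (hL.comp ?_).const_mul _
      exact tendsto_id.atTop_mul_const_of_neg (by linarith)
    · rw [Set.indicator_of_notMem (fun hh => absurd hh.2 (by linarith))]
      have := (htop.comp (tendsto_id.atTop_mul_const (show 0 < v - 1 by linarith))).const_mul
        ((α * v ^ (α - 1) : ℝ) : ℂ)
      simpa using this

lemma J_eq (a α s : ℝ) (ha : 0 < a) (hα0 : 0 < α) (hα1 : α < 1) (hs : 0 < s) (j : ℂ)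
    (hJ : Tendsto
      (fun R : ℝ => ∫ x in (0:ℝ)..R,
        ((x ^ α : ℝ) : ℂ) * Complex.exp (((a * x ^ 2 - s * x : ℝ) : ℂ) * Complex.I))
      atTop (nhds j))
    (E : ℝ → ℂ) (C : ℝ) (hE : ∀ y : ℝ, HasDerivAt E (Complex.exp ((a * y^2 : ℝ) * I)) y)
    (h1 : ∀ y, ‖E y‖ ≤ C) (h2 : ∀ y, y * ‖E y‖ ≤ C) :
    j = -(((s / (2 * a)) ^ α : ℝ) : ℂ) * Complex.exp ((-(s^2 / a / 4) : ℝ) * I) *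
      ∫ v in Set.Ioi (0:ℝ), ((α * v ^ (α - 1) : ℝ) : ℂ) * E (s / (2 * a) * (v - 1)) := by
  set l := s / (2 * a) with hl
  have hl0 : 0 < l := by positivity
  set c := Complex.exp ((-(s^2 / a / 4) : ℝ) * I) with hc
  have hEc : Continuous E := continuous_iff_continuousAt.mpr fun y => (hE y).continuousAt
  have hb : ∀ x, 0 < x → (1 + x) * ‖E (x - l)‖ ≤ (2 + l) * C := by
    intro x hx
    have a1 := h1 (x - l)
    have a2 := h2 (x - l)
    nlinarith
  have hint := int_aux α hα0 hα1 (fun x => E (x - l)) (hEc.comp (by fun_prop)) _ hb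
  have hparts : ∀ R : ℝ, 0 < R → ∫ x in (0:ℝ)..R,
        ((x ^ α : ℝ) : ℂ) * Complex.exp (((a * x ^ 2 - s * x : ℝ) : ℂ) * Complex.I) =
        c * (((R ^ α : ℝ) : ℂ) * E (R - l) -
          ∫ x in (0:ℝ)..R, ((α * x ^ (α - 1) : ℝ) : ℂ) * E (x - l)) := by
    intro R hR
    have hd : ∀ x : ℝ, HasDerivAt (fun x : ℝ => E (x - l)) 
        (Complex.exp ((a * (x - l)^2 : ℝ) * I)) x := fun x => (hE (x - l)).comp_sub_const x l
    have e : ∀ x : ℝ, Complex.exp (((a * x ^ 2 - s * x : ℝ) : ℂ) * Complex.I)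
        = c * Complex.exp ((a * (x - l)^2 : ℝ) * I) := by
      intro x
      rw [hc, ← Complex.exp_add, ← add_mul, ← Complex.ofReal_add]
      congr 3
      rw [hl]; field_simp; ring
    have hii : IntervalIntegrable (fun x : ℝ => ((α * x ^ (α - 1) : ℝ) : ℂ)) volume 0 R := by
      have h : IntervalIntegrable (fun x : ℝ => α * x ^ (α - 1)) volume 0 R :=
        (intervalIntegral.intervalIntegrable_rpow' (by linarith)).const_mul α
      exact ⟨h.1.ofReal, h.2.ofReal⟩
    have hp := intervalIntegral.integral_mul_deriv_eq_deriv_mul_of_hasDerivAt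
      (a := 0) (b := R) (u := fun x : ℝ => ((x ^ α : ℝ) : ℂ)) (v := fun x => E (x - l))
      (u' := fun x : ℝ => ((α * x ^ (α - 1) : ℝ) : ℂ))
      (v' := fun x => Complex.exp ((a * (x - l)^2 : ℝ) * I))
      (Complex.continuous_ofReal.comp (Real.continuous_rpow_const hα0.le)).continuousOn
      (hEc.comp (by fun_prop)).continuousOn
      (fun x hx => by
        rw [min_eq_left hR.le] at hx
        exact (Real.hasDerivAt_rpow_const (Or.inl hx.1.ne')).ofReal_comp)
      (fun x _ => hd x) hii
      (Continuous.intervalIntegrable (by fun_prop) _ _)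
    rw [Real.zero_rpow hα0.ne'] at hp
    simp only [ofReal_zero, zero_mul, sub_zero] at hp
    rw [← hp, ← intervalIntegral.integral_const_mul]
    refine intervalIntegral.integral_congr fun x _ => ?_
    simp only [e]
    ring
  have hbd : Tendsto (fun R : ℝ => ((R ^ α : ℝ) : ℂ) * E (R - l)) atTop (nhds 0) := by
    refine squeeze_zero_norm' (a := fun R => ((2 + l) * C) * R ^ (-(1 - α))) ?_ ?_
    · filter_upwards [eventually_gt_atTop 0] with R hR
      have := hb R hR
      have hn := norm_nonneg (E (R - l))
      have hr : 0 < R ^ α := Real.rpow_pos_of_pos hR _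
      rw [norm_mul, Complex.norm_real, Real.norm_of_nonneg hr.le,
        show -(1 - α) = α - 1 by ring, Real.rpow_sub_one hR.ne']
      have : ‖E (R - l)‖ ≤ (2 + l) * C / R := by
        rw [le_div_iff₀ hR]; nlinarith
      calc _ ≤ R ^ α * ((2 + l) * C / R) := by gcongr
        _ = _ := by ring
    · simpa using (tendsto_rpow_neg_atTop (show 0 < 1 - α by linarith)).const_mul ((2 + l) * C)
  have hlim := (hbd.sub (intervalIntegral_tendsto_integral_Ioi 0 hint tendsto_id)).const_mul c
  have hlim2 := hlim.congr' (f₂ := fun R : ℝ => ∫ x in (0:ℝ)..R,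
        ((x ^ α : ℝ) : ℂ) * Complex.exp (((a * x ^ 2 - s * x : ℝ) : ℂ) * Complex.I)) (by
    filter_upwards [eventually_gt_atTop 0] with R hR
    exact (hparts R hR).symm)
  rw [tendsto_nhds_unique hJ hlim2]
  have hsub := integral_comp_mul_left_Ioi' 
    (fun x : ℝ => ((α * x ^ (α - 1) : ℝ) : ℂ) * E (x - l)) 0 hl0
  rw [mul_zero] at hsub
  rw [← hsub]
  have : ∫ v in Set.Ioi (0:ℝ), ((α * (l * v) ^ (α - 1) : ℝ) : ℂ) * E (l * v - l) =
      ((l ^ (α - 1) : ℝ) : ℂ) * ∫ v in Set.Ioi (0:ℝ),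
        ((α * v ^ (α - 1) : ℝ) : ℂ) * E (l * (v - 1)) := by
    rw [← integral_const_mul]
    refine setIntegral_congr_fun measurableSet_Ioi fun v hv => ?_
    have hv' : (0:ℝ) < v := hv
    rw [Real.mul_rpow hl0.le hv'.le, show l * v - l = l * (v - 1) by ring]
    push_cast; ring
  rw [this, show l ^ α = l * l ^ (α - 1) by rw [Real.rpow_sub_one hl0.ne']; field_simp,
    Complex.real_smul]
  push_cast
  ring

theorem stmt16 (a α : ℝ) (ha : 0 < a) (hα0 : 0 < α) (hα1 : α < 1)
    (J : ℝ → ℂ)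
    (hJ : ∀ s : ℝ, Tendsto
      (fun R : ℝ => ∫ x in (0:ℝ)..R,
        ((x ^ α : ℝ) : ℂ) * Complex.exp (((a * x ^ 2 - s * x : ℝ) : ℂ) * Complex.I))
      atTop (nhds (J s))) :
    Tendsto (fun s : ℝ => J s /
        ((Real.sqrt π * (2:ℝ) ^ (-α) * a ^ (-(α + 1/2)) * s ^ α : ℝ) *
          Complex.exp ((((π - s ^ 2 / a) / 4 : ℝ) : ℂ) * Complex.I)))
      atTop (nhds 1) ∧
    Tendsto (fun s : ℝ => ‖J s‖ / s ^ α) atTop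
      (nhds (Real.sqrt π * (2:ℝ) ^ (-α) * a ^ (-(α + 1/2)))) := by
  set A : ℝ := Real.sqrt π * (2:ℝ) ^ (-α) * a ^ (-(α + 1/2)) with hA
  have hA0 : 0 < A := by
    have := Real.sqrt_pos.mpr Real.pi_pos
    positivity
  have hfirst : Tendsto (fun s : ℝ => J s /
        ((A * s ^ α : ℝ) * Complex.exp ((((π - s ^ 2 / a) / 4 : ℝ) : ℂ) * Complex.I)))
      atTop (nhds 1) := by
    obtain ⟨E, C, hE, h1, h2, hL⟩ := fresnel_prim a ha
    have hEc : Continuous E := continuous_iff_continuousAt.mpr fun y => (hE y).continuousAt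
    set L : ℂ := (Real.sqrt (π / a) : ℝ) * Complex.exp ((π / 4 : ℝ) * I) with hLdef
    have hL0 : L ≠ 0 := by
      refine mul_ne_zero ?_ (Complex.exp_ne_zero _)
      have := Real.sqrt_pos.mpr (div_pos Real.pi_pos ha)
      exact_mod_cast this.ne'
    have hl : Tendsto (fun s : ℝ => s / (2 * a)) atTop atTop :=
      tendsto_id.atTop_div_const (by positivity)
    have hlim := ((limit_aux α hα0 hα1 E C _ hEc h1 h2 hL).comp hl).const_mul (-L⁻¹)
    rw [neg_mul_neg, inv_mul_cancel₀ hL0] at hlim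
    refine hlim.congr' ?_
    filter_upwards [eventually_gt_atTop 0] with s hs
    rw [J_eq a α s ha hα0 hα1 hs (J s) (hJ s) E C hE h1 h2]
    simp only [Function.comp]
    set Q := ∫ v in Set.Ioi (0:ℝ), ((α * v ^ (α - 1) : ℝ) : ℂ) * E (s / (2 * a) * (v - 1))
    have hden : ((A * s ^ α : ℝ) : ℂ) * Complex.exp ((((π - s ^ 2 / a) / 4 : ℝ) : ℂ) * Complex.I)
        = (((s / (2 * a)) ^ α : ℝ) : ℂ) * Complex.exp ((-(s^2 / a / 4) : ℝ) * I) * L := by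
      have r : A * s ^ α = (s / (2 * a)) ^ α * Real.sqrt (π / a) := by
        rw [hA, Real.div_rpow hs.le (by positivity), Real.mul_rpow zero_le_two ha.le,
          Real.sqrt_div Real.pi_pos.le, Real.rpow_neg zero_le_two, Real.rpow_neg ha.le,
          Real.rpow_add ha, Real.sqrt_eq_rpow a]
        field_simp
      rw [r, hLdef, show (π - s ^ 2 / a) / 4 = -(s^2 / a / 4) + π / 4 by ring]
      push_cast
      rw [add_mul, Complex.exp_add]
      ring
    rw [hden]
    have p1 : (((s / (2 * a)) ^ α : ℝ) : ℂ) ≠ 0 := by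
      have : 0 < (s / (2 * a)) ^ α := by positivity
      exact_mod_cast this.ne'
    have p2 := Complex.exp_ne_zero (((-(s^2 / a / 4) : ℝ) : ℂ) * I)
    field_simp
  refine ⟨hfirst, ?_⟩
  have h := hfirst.norm.const_mul A
  rw [norm_one, mul_one] at h
  refine h.congr' ?_
  filter_upwards [eventually_gt_atTop 0] with s hs
  have : 0 < s ^ α := Real.rpow_pos_of_pos hs _
  rw [norm_div, norm_mul, Complex.norm_exp_ofReal_mul_I, Complex.norm_real,
    Real.norm_of_nonneg (by positivity)]
  field_simp
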